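/- Multivariate integration over the unit ball of C^∞([0,1]^d) is not strongly tractable: for every positive integer n and every ε ∈ (0,1) there exists a dimension d such that every linear algorithm A_{n,d}(f) = Σ_{j=1}^n a_j f(x_j) using n function values satisfies sup_{f ∈ B_d} |I_d(f) − A_{n,d}(f)| > ε. Consequently, the minimal number n(ε, B_d) of function values needed to achieve worst-case error ε admits no bound independent of d. -/

import Mathlib

open MeasureTheory

/-- Partial derivative of `f : ℝ^d → ℝ` with respect to the `i`-th coordinate. -/
noncomputable def partialDeriv {d : ℕ} (i : Fin d) (f : (Fin d → ℝ) → ℝ) :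
    (Fin d → ℝ) → ℝ :=
  fun x => fderiv ℝ f x (Pi.single i 1)

/-- The multiindex derivative `D^α f` for a multiindex `α = (α_1, …, α_d)`. -/
noncomputable def multiDeriv {d : ℕ} (α : Fin d → ℕ) (f : (Fin d → ℝ) → ℝ) :
    (Fin d → ℝ) → ℝ :=
  (List.finRange d).foldr (fun i g => (partialDeriv i)^[α i] g) f

/-- The unit cube `[0,1]^d`. -/
def cube (d : ℕ) : Set (Fin d → ℝ) := Set.Icc 0 1

/-- The unit ball `B_d` of `C^∞([0,1]^d)`: infinitely differentiable functions all of whose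
partial derivatives (of every order, including the function itself) are bounded by 1 on the
unit cube. -/
def unitBall (d : ℕ) : Set ((Fin d → ℝ) → ℝ) :=
  {f | ContDiff ℝ (⊤ : ℕ∞) f ∧ ∀ (α : Fin d → ℕ), ∀ x ∈ cube d, |multiDeriv α f x| ≤ 1}

open Polynomial in
/-- Products over blocks of `c j` minus a product of one-variable polynomials. -/
noncomputable def blockFun {d n : ℕ} (b : Fin d → Fin n) (c : Fin n → ℝ) (P : Fin d → ℝ[X]) :
    (Fin d → ℝ) → ℝ :=
  fun t => ∏ j, (c j - ∏ i, if b i = j then (P i).eval (t i) else 1)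

open Polynomial in
lemma contDiff_blockFun {d n : ℕ} (b : Fin d → Fin n) (c : Fin n → ℝ) (P : Fin d → ℝ[X]) :
    ContDiff ℝ (⊤ : ℕ∞) (blockFun b c P) := by
  unfold blockFun
  apply contDiff_prod
  intro j _
  apply contDiff_const.sub
  apply contDiff_prod
  intro i _
  split_ifs
  · have h := (P i).contDiff_aeval (𝕜 := ℝ) (⊤ : ℕ∞)
    simp only [Polynomial.coe_aeval_eq_eval] at h
    exact h.comp (contDiff_apply ℝ ℝ i)
  · exact contDiff_const

open Polynomial in
lemma blockFun_split {d n : ℕ} (b : Fin d → Fin n) (c : Fin n → ℝ) (P : Fin d → ℝ[X])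
    (t : Fin d → ℝ) (i : Fin d) :
    blockFun b c P t =
      (c (b i) - (P i).eval (t i) *
        ∏ k ∈ Finset.univ.erase i, if b k = b i then (P k).eval (t k) else 1) *
      ∏ j ∈ Finset.univ.erase (b i),
        (c j - ∏ k ∈ Finset.univ.erase i, if b k = j then (P k).eval (t k) else 1) := by
  unfold blockFun
  rw [← Finset.mul_prod_erase Finset.univ _ (Finset.mem_univ (b i)),
    ← Finset.mul_prod_erase Finset.univ _ (Finset.mem_univ i)]
  simp only [if_true]
  congr 1
  apply Finset.prod_congr rfl
  intro j hj
  have hj' : b i ≠ j := (Finset.ne_of_mem_erase hj).symm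
  rw [← Finset.mul_prod_erase Finset.univ _ (Finset.mem_univ i)]
  simp [hj']

open Polynomial in
lemma partialDeriv_blockFun {d n : ℕ} (b : Fin d → Fin n) (c : Fin n → ℝ) (P : Fin d → ℝ[X])
    (i : Fin d) :
    partialDeriv i (blockFun b c P) =
      blockFun b (Function.update c (b i) 0) (Function.update P i (derivative (P i))) := by
  funext t
  unfold partialDeriv
  have h1 : HasDerivAt (fun s => blockFun b c P (Function.update t i s))
      (fderiv ℝ (blockFun b c P) t (Pi.single i 1)) (t i) := by
    have hd : HasFDerivAt (blockFun b c P) (fderiv ℝ (blockFun b c P) t)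
        (Function.update t i (t i)) := by
      rw [Function.update_eq_self]
      exact ((contDiff_blockFun b c P).differentiable (by simp) t).hasFDerivAt
    exact hd.comp_hasDerivAt (t i) (hasDerivAt_update t i (t i))
  set Q := ∏ k ∈ Finset.univ.erase i, if b k = b i then (P k).eval (t k) else 1 with hQ
  set H := ∏ j ∈ Finset.univ.erase (b i),
        (c j - ∏ k ∈ Finset.univ.erase i, if b k = j then (P k).eval (t k) else 1) with hH
  have h2 : (fun s => blockFun b c P (Function.update t i s)) =
      fun s => (c (b i) - (P i).eval s * Q) * H := by
    funext s
    rw [blockFun_split b c P _ i, Function.update_self]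
    have : ∀ j, (∏ k ∈ Finset.univ.erase i,
        if b k = j then (P k).eval (Function.update t i s k) else 1) =
        ∏ k ∈ Finset.univ.erase i, if b k = j then (P k).eval (t k) else 1 := by
      intro j
      apply Finset.prod_congr rfl
      intro k hk
      rw [Function.update_of_ne (Finset.ne_of_mem_erase hk)]
    simp only [this, hQ, hH]
  rw [h2] at h1
  have h3 : HasDerivAt (fun s => (c (b i) - (P i).eval s * Q) * H)
      ((0 - (derivative (P i)).eval (t i) * Q) * H) (t i) :=
    (((hasDerivAt_const _ _).sub (((P i).hasDerivAt (t i)).mul_const Q))).mul_const H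
  rw [h1.unique h3, blockFun_split _ _ _ t i]
  simp only [Function.update_self]
  have : ∀ j, (∏ k ∈ Finset.univ.erase i,
        if b k = j then (Function.update P i (derivative (P i)) k).eval (t k) else 1) =
        ∏ k ∈ Finset.univ.erase i, if b k = j then (P k).eval (t k) else 1 := by
    intro j
    apply Finset.prod_congr rfl
    intro k hk
    rw [Function.update_of_ne (Finset.ne_of_mem_erase hk)]
  simp only [this]
  congr 1
  apply Finset.prod_congr rfl
  intro j hj
  rw [Function.update_of_ne (Finset.ne_of_mem_erase hj)]

open Polynomial in
/-- The class of functions closed under partial derivatives. -/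
def goodSet {d n : ℕ} (b : Fin d → Fin n) : Set ((Fin d → ℝ) → ℝ) :=
  {f | ∃ (c : Fin n → ℝ) (P : Fin d → ℝ[X]), f = blockFun b c P ∧
    (∀ i k, ∀ s ∈ Set.Icc (0 : ℝ) 1, |((derivative^[k]) (P i)).eval s| ≤ 1) ∧
    ∀ j, c j = 0 ∨ (c j = 1 ∧ ∀ i, b i = j → ∀ s ∈ Set.Icc (0 : ℝ) 1, 0 ≤ (P i).eval s)}

lemma goodSet_partialDeriv {d n : ℕ} {b : Fin d → Fin n} {f : (Fin d → ℝ) → ℝ}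
    (hf : f ∈ goodSet b) (i : Fin d) : partialDeriv i f ∈ goodSet b := by
  obtain ⟨c, P, rfl, h1, h2⟩ := hf
  refine ⟨_, _, partialDeriv_blockFun b c P i, ?_, ?_⟩
  · intro k m s hs
    by_cases hk : k = i
    · subst hk
      rw [Function.update_self, ← Function.iterate_succ_apply]
      exact h1 k (m + 1) s hs
    · rw [Function.update_of_ne hk]
      exact h1 k m s hs
  · intro j
    by_cases hj : j = b i
    · subst hj
      left
      simp
    · rw [Function.update_of_ne hj]
      rcases h2 j with h | ⟨h, h'⟩
      · exact Or.inl h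
      · refine Or.inr ⟨h, ?_⟩
        intro k hk s hs
        have : k ≠ i := by
          rintro rfl
          exact hj hk.symm
        rw [Function.update_of_ne this]
        exact h' k hk s hs

lemma goodSet_multiDeriv {d n : ℕ} {b : Fin d → Fin n} {f : (Fin d → ℝ) → ℝ}
    (hf : f ∈ goodSet b) (α : Fin d → ℕ) : multiDeriv α f ∈ goodSet b := by
  unfold multiDeriv
  have hit : ∀ (i : Fin d) (m : ℕ) (g : (Fin d → ℝ) → ℝ), g ∈ goodSet b →
      (partialDeriv i)^[m] g ∈ goodSet b := by
    intro i m
    induction m with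
    | zero => intro g hg; exact hg
    | succ m ih => intro g hg; exact ih _ (goodSet_partialDeriv hg i)
  induction List.finRange d with
  | nil => exact hf
  | cons i l ih => exact hit _ _ _ ih

lemma goodSet_bound {d n : ℕ} {b : Fin d → Fin n} {f : (Fin d → ℝ) → ℝ}
    (hf : f ∈ goodSet b) (t : Fin d → ℝ) (ht : t ∈ cube d) : |f t| ≤ 1 := by
  obtain ⟨c, P, rfl, h1, h2⟩ := hf
  have hti : ∀ i, t i ∈ Set.Icc (0 : ℝ) 1 := fun i => ⟨ht.1 i, ht.2 i⟩
  unfold blockFun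
  rw [Finset.abs_prod]
  apply Finset.prod_le_one
  · intro j _; exact abs_nonneg _
  intro j _
  have hb : |∏ i, if b i = j then (P i).eval (t i) else 1| ≤ 1 := by
    rw [Finset.abs_prod]
    apply Finset.prod_le_one
    · intro i _; exact abs_nonneg _
    intro i _
    split_ifs
    · exact h1 i 0 _ (hti i)
    · simp
  rcases h2 j with h | ⟨h, h'⟩
  · rw [h, zero_sub, abs_neg]; exact hb
  · have : 0 ≤ ∏ i, if b i = j then (P i).eval (t i) else 1 := by
      apply Finset.prod_nonneg
      intro i _
      split_ifs with hi
      · exact h' i hi _ (hti i)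
      · simp
    rw [h, abs_le]
    rw [abs_le] at hb
    constructor <;> linarith [hb.2]

open Polynomial in
/-- The one-variable building block `1 - (X - y)^2 / 2`. -/
noncomputable def qpoly (y : ℝ) : ℝ[X] := 1 - C (1 / 2) * (X - C y) ^ 2

lemma qpoly_eval (y s : ℝ) : (qpoly y).eval s = 1 - (s - y) ^ 2 / 2 := by
  simp [qpoly]; ring

open Polynomial in
lemma qpoly_deriv (y : ℝ) : derivative (qpoly y) = C y - X := by
  have h : (C (1 / 2 : ℝ) : ℝ[X]) * 2 = 1 := by
    rw [show (2 : ℝ[X]) = C 2 from rfl, ← C_mul]; norm_num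
  have : derivative (qpoly y) = -(C (1 / 2 : ℝ) * 2) * (X - C y) := by
    simp only [qpoly, derivative_sub, derivative_one, derivative_C_mul, derivative_pow,
      derivative_X, derivative_C, map_natCast]
    push_cast
    ring
  rw [this, h]; ring

lemma qpoly_range {y s : ℝ} (hy : y ∈ Set.Icc (0 : ℝ) 1) (hs : s ∈ Set.Icc (0 : ℝ) 1) :
    0 ≤ (qpoly y).eval s ∧ (qpoly y).eval s ≤ 1 := by
  rw [qpoly_eval]
  obtain ⟨h1, h2⟩ := hy
  obtain ⟨h3, h4⟩ := hs
  constructor <;> nlinarith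

open Polynomial in
lemma qpoly_bound {y s : ℝ} (hy : y ∈ Set.Icc (0 : ℝ) 1) (hs : s ∈ Set.Icc (0 : ℝ) 1) (k : ℕ) :
    |((derivative^[k]) (qpoly y)).eval s| ≤ 1 := by
  match k with
  | 0 =>
    have := qpoly_range hy hs
    rw [Function.iterate_zero, id, abs_le]
    constructor <;> linarith
  | 1 =>
    rw [Function.iterate_one, qpoly_deriv]
    obtain ⟨h1, h2⟩ := hy
    obtain ⟨h3, h4⟩ := hs
    simp only [eval_sub, eval_C, eval_X]
    rw [abs_le]
    constructor <;> linarith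
  | 2 =>
    rw [Function.iterate_succ_apply, Function.iterate_one, qpoly_deriv]
    simp
  | k + 3 =>
    rw [Function.iterate_succ_apply, Function.iterate_succ_apply, Function.iterate_succ_apply,
      qpoly_deriv]
    simp

lemma qpoly_integral {y : ℝ} :
    ∫ s in Set.Icc (0 : ℝ) 1, (qpoly y).eval s ≤ 23 / 24 := by
  rw [integral_Icc_eq_integral_Ioc, ← intervalIntegral.integral_of_le zero_le_one]
  have : ∫ s in (0 : ℝ)..1, (qpoly y).eval s = 1 - ((1 - y) ^ 3 + y ^ 3) / 6 := by
    rw [intervalIntegral.integral_eq_sub_of_hasDerivAt (f := fun s => s - (s - y) ^ 3 / 6)]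
    · ring
    · intro s _
      rw [qpoly_eval]
      have := (hasDerivAt_id s).sub ((((hasDerivAt_id s).sub_const y).pow 3).div_const 6)
      refine this.congr_deriv ?_
      simp only [id, Nat.cast_ofNat]
      ring
    · exact (qpoly y).continuous.intervalIntegrable _ _
  rw [this]
  nlinarith [sq_nonneg (2 * y - 1)]

lemma cube_eq (d : ℕ) : cube d = Set.pi Set.univ (fun _ => Set.Icc (0 : ℝ) 1) := by
  unfold cube
  rw [Set.pi_univ_Icc]; rfl

lemma cube_restrict (d : ℕ) : (volume : Measure (Fin d → ℝ)).restrict (cube d) =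
    Measure.pi (fun _ => (volume : Measure ℝ).restrict (Set.Icc 0 1)) := by
  rw [cube_eq, volume_pi, Measure.restrict_pi_pi]

lemma cube_volume (d : ℕ) : volume (cube d) = 1 := by
  rw [cube_eq, volume_pi_pi]; simp

lemma cube_integrableOn {d : ℕ} {f : (Fin d → ℝ) → ℝ} (hf : Continuous f) :
    IntegrableOn f (cube d) :=
  hf.continuousOn.integrableOn_compact isCompact_Icc

lemma one_sub_sum_le_prod {n : ℕ} (s : Finset (Fin n)) (g : Fin n → ℝ)
    (h : ∀ j, 0 ≤ g j ∧ g j ≤ 1) :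
    1 - ∑ j ∈ s, g j ≤ ∏ j ∈ s, (1 - g j) := by
  have h' : 0 ≤ ∏ j ∈ s, (1 - g j) ∧ ∏ j ∈ s, (1 - g j) ≤ 1 :=
    ⟨Finset.prod_nonneg fun j _ => by linarith [(h j).2],
      Finset.prod_le_one (fun j _ => by linarith [(h j).2]) (fun j _ => by linarith [(h j).1])⟩
  clear h'
  induction s using Finset.induction_on with
  | empty => simp
  | insert j s hj ih =>
    have h' : ∏ j ∈ s, (1 - g j) ≤ 1 :=
      Finset.prod_le_one (fun j _ => by linarith [(h j).2]) (fun j _ => by linarith [(h j).1])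
    rw [Finset.sum_insert hj, Finset.prod_insert hj]
    nlinarith [(h j).1]

/-- Multivariate integration over the unit ball of `C^∞([0,1]^d)` is not strongly tractable:
for every positive integer `n` and every `ε ∈ (0,1)` there exists a dimension `d` such that
every linear algorithm using `n` function values has worst-case error exceeding `ε`. -/
theorem not_strongly_tractable (n : ℕ) (hn : 0 < n) (ε : ℝ) (hε : ε ∈ Set.Ioo (0 : ℝ) 1) :
    ∃ d : ℕ, 0 < d ∧
      ∀ (a : Fin n → ℝ) (x : Fin n → Fin d → ℝ), (∀ j, x j ∈ cube d) →
        ε < sSup ((fun f => |(∫ t in cube d, f t) - ∑ j, a j * f (x j)|) '' unitBall d) := by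
  have hn' : (0 : ℝ) < n := by exact_mod_cast hn
  obtain ⟨m, hm⟩ : ∃ m : ℕ, (23 / 24 : ℝ) ^ m < (1 - ε) / n :=
    exists_pow_lt_of_lt_one (div_pos (by linarith [hε.2]) hn') (by norm_num)
  have hm0 : 0 < m ∨ m = 0 := by omega
  have hmpos : 0 < m := by
    rcases hm0 with h | h
    · exact h
    · subst h
      rw [pow_zero, lt_div_iff₀ hn'] at hm
      have : (1 : ℝ) ≤ n := by exact_mod_cast hn
      linarith [hε.1]
  rw [lt_div_iff₀ hn'] at hm
  refine ⟨n * m, Nat.mul_pos hn hmpos, ?_⟩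
  intro a x hx
  set b : Fin (n * m) → Fin n := fun i => (finProdFinEquiv.symm i).1 with hb
  have hxi : ∀ j i, x j i ∈ Set.Icc (0 : ℝ) 1 := fun j i => ⟨(hx j).1 i, (hx j).2 i⟩
  set P := fun i => qpoly (x (b i) i) with hP
  set f := blockFun b (fun _ => 1) P with hf
  have hgood : f ∈ goodSet b :=
    ⟨_, _, hf, fun i k s hs => qpoly_bound (hxi _ _) hs k,
      fun j => Or.inr ⟨rfl, fun i _ s hs => (qpoly_range (hxi _ _) hs).1⟩⟩
  have hball : f ∈ unitBall (n * m) :=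
    ⟨contDiff_blockFun _ _ _, fun α t ht => goodSet_bound (goodSet_multiDeriv hgood α) t ht⟩
  have hzero : ∀ j, f (x j) = 0 := by
    intro j
    rw [hf]
    unfold blockFun
    apply Finset.prod_eq_zero (Finset.mem_univ j)
    rw [sub_eq_zero, eq_comm]
    apply Finset.prod_eq_one
    intro i _
    split_ifs with hi
    · rw [hP, qpoly_eval, hi]; simp
    · rfl
  have hcont : ∀ j, Continuous (fun t : Fin (n * m) → ℝ =>
      ∏ i, if b i = j then (P i).eval (t i) else 1) := by
    intro j
    apply continuous_finsetProd
    intro i _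
    split_ifs
    · exact (P i).continuous.comp (continuous_apply i)
    · exact continuous_const
  have hint : ∀ j, ∫ t in cube (n * m), (∏ i, if b i = j then (P i).eval (t i) else 1)
      ≤ (23 / 24) ^ m := by
    intro j
    rw [cube_restrict,
      integral_fintype_prod_eq_prod (fun i s => if b i = j then (P i).eval s else 1)]
    calc _ ≤ ∏ i, (if b i = j then (23 / 24 : ℝ) else 1) := by
          apply Finset.prod_le_prod
          · intro i _
            apply setIntegral_nonneg measurableSet_Icc
            intro s hs
            split_ifs
            · exact (qpoly_range (hxi _ _) hs).1
            · simp
          · intro i _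
            split_ifs
            · exact qpoly_integral
            · simp
      _ = (23 / 24) ^ m := by
          rw [← finProdFinEquiv.prod_comp, Fintype.prod_prod_type]
          simp only [hb, Equiv.symm_apply_apply, Finset.prod_const, Finset.card_univ,
            Fintype.card_fin]
          rw [Finset.prod_eq_single j]
          · simp
          · intro k _ hk
            simp [hk]
          · simp
  have hlow : ε < ∫ t in cube (n * m), f t := by
    have h1 : ∫ t in cube (n * m),
        (1 - ∑ j, ∏ i, if b i = j then (P i).eval (t i) else 1) ≤ ∫ t in cube (n * m), f t := by
      apply setIntegral_mono_on
      · apply cube_integrableOn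
        exact continuous_const.sub (continuous_finsetSum _ fun j _ => hcont j)
      · exact cube_integrableOn (contDiff_blockFun _ _ _).continuous
      · exact measurableSet_Icc
      · intro t ht
        apply one_sub_sum_le_prod
        intro j
        have hr : ∀ i, 0 ≤ (if b i = j then (P i).eval (t i) else 1) ∧
            (if b i = j then (P i).eval (t i) else 1) ≤ 1 := by
          intro i
          split_ifs
          · exact qpoly_range (hxi _ _) ⟨ht.1 i, ht.2 i⟩
          · simp
        exact ⟨Finset.prod_nonneg fun i _ => (hr i).1,
          Finset.prod_le_one (fun i _ => (hr i).1) (fun i _ => (hr i).2)⟩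
    rw [integral_sub (cube_integrableOn continuous_const)
      (cube_integrableOn (continuous_finsetSum _ fun j _ => hcont j)),
      integral_finsetSum _ (fun j _ => cube_integrableOn (hcont j))] at h1
    have h2 := Finset.sum_le_sum (fun j (_ : j ∈ Finset.univ) => hint j)
    have h3 : ∫ t in cube (n * m), (1 : ℝ) = 1 := by
      simp [Measure.real, cube_volume]
    rw [h3] at h1
    simp only [Finset.sum_const, Finset.card_univ, Fintype.card_fin, nsmul_eq_mul] at h2
    linarith
  have hmem : |(∫ t in cube (n * m), f t) - ∑ j, a j * f (x j)| ∈
      ((fun f => |(∫ t in cube (n * m), f t) - ∑ j, a j * f (x j)|) '' unitBall (n * m)) :=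
    ⟨f, hball, rfl⟩
  refine lt_of_lt_of_le ?_ (le_csSup ?_ hmem)
  · simp only [hzero, mul_zero, Finset.sum_const_zero, sub_zero]
    exact lt_of_lt_of_le hlow (le_abs_self _)
  · refine ⟨1 + ∑ j, |a j|, ?_⟩
    rintro _ ⟨g, hg, rfl⟩
    have hg1 : ∀ t ∈ cube (n * m), |g t| ≤ 1 := by
      intro t ht
      have := hg.2 0 t ht
      have h0 : multiDeriv 0 g = g := by
        unfold multiDeriv
        induction List.finRange (n * m) with
        | nil => rfl
        | cons i l ih => simp
      rwa [h0] at this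
    have hI : |∫ t in cube (n * m), g t| ≤ 1 := by
      have := norm_setIntegral_le_of_norm_le_const (μ := volume) (s := cube (n * m)) (f := g)
        (C := 1) (by rw [cube_volume]; simp) (fun t ht => hg1 t ht)
      simpa [Measure.real, cube_volume] using this
    have hS : |∑ j, a j * g (x j)| ≤ ∑ j, |a j| := by
      refine (Finset.abs_sum_le_sum_abs _ _).trans (Finset.sum_le_sum fun j _ => ?_)
      rw [abs_mul]
      exact mul_le_of_le_one_right (abs_nonneg _) (hg1 _ (hx j))
    exact (abs_sub _ _).trans (add_le_add hI hS)
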